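/- arXiv:0912.0555 — 6 statements merged into one kernel-verified Lean document; each statement's English description precedes it below -/
import Mathlib

section
/- Let (V,T) be a labelled transition system whose transitions carry pairs of labels (a⃗,b⃗) of words over Σ+{ι}, and suppose it is reflexive (every state v has a transition v →[ι⃗/ι⃗] v) and ι-transitive (if v →[ι⃗/ι⃗] v₁, v₁ →[a⃗/b⃗] v₂ and v₂ →[ι⃗/ι⃗] v′ then v →[a⃗/b⃗] v′). Then weak bisimilarity (where transitions labelled solely with ι's are treated as silent) coincides with strong bisimilarity: two states are weakly bisimilar if and only if they are strongly bisimilar. In particular, every weak bisimulation on such a system is a strong bisimulation. -/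
/-!
STATEMENT 0: on a reflexive and ι-transitive LTS whose transitions carry pairs
of words over `Σ + {ι}` (here: `Option Sig`, with `none` playing the role of
`ι`), weak bisimilarity coincides with strong bisimilarity, and every weak
bisimulation is a strong bisimulation.
-/

namespace Stmt0

/-- The word `ι⃗` of length `k`. -/
def iotaW (Sig : Type) (k : ℕ) : List (Option Sig) := List.replicate k none

/-- A reflexive and ι-transitive labelled transition system of
`(k,l)`-transitions over the state space `V`: transitions are labelled by
pairs of words over `Σ + {ι}` of lengths `k` and `l` respectively. -/
structure LTS (Sig V : Type) (k l : ℕ) where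
  /-- the transition relation `v →[a/b] v'` -/
  Trans : V → List (Option Sig) → List (Option Sig) → V → Prop
  /-- upper labels have length `k` -/
  len_left : ∀ {v a b v'}, Trans v a b v' → a.length = k
  /-- lower labels have length `l` -/
  len_right : ∀ {v a b v'}, Trans v a b v' → b.length = l
  /-- reflexivity: every state has a transition `v →[ι⃗/ι⃗] v` -/
  refl : ∀ v, Trans v (iotaW Sig k) (iotaW Sig l) v
  /-- ι-transitivity -/
  iota_trans : ∀ {v v₁ v₂ v' a b},
    Trans v (iotaW Sig k) (iotaW Sig l) v₁ → Trans v₁ a b v₂ →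
    Trans v₂ (iotaW Sig k) (iotaW Sig l) v' → Trans v a b v'

variable {Sig V : Type} {k l : ℕ}

/-- A silent transition: one whose labels consist solely of `ι`'s. -/
def Silent (L : LTS Sig V k l) (v w : V) : Prop :=
  L.Trans v (iotaW Sig k) (iotaW Sig l) w

/-- `v ⇒ w`: a (possibly empty) sequence of silent transitions. -/
def SilentStar (L : LTS Sig V k l) : V → V → Prop :=
  Relation.ReflTransGen (Silent L)

/-- (Strong) simulation. -/
def IsStrongSim (L : LTS Sig V k l) (S : V → V → Prop) : Prop :=
  ∀ v w, S v w → ∀ a b v', L.Trans v a b v' →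
    ∃ w', L.Trans w a b w' ∧ S v' w'

/-- Strong bisimulation: `S` and its inverse are strong simulations. -/
def IsStrongBisim (L : LTS Sig V k l) (S : V → V → Prop) : Prop :=
  IsStrongSim L S ∧ IsStrongSim L (flip S)

/-- Weak simulation: a silent transition is matched by a sequence of silent
transitions; a non-silent transition is matched by silent transitions, then a
transition with the same label, then silent transitions. -/
def IsWeakSim (L : LTS Sig V k l) (S : V → V → Prop) : Prop :=
  ∀ v w, S v w → ∀ a b v', L.Trans v a b v' →
    ((a = iotaW Sig k ∧ b = iotaW Sig l) →
      ∃ w', SilentStar L w w' ∧ S v' w') ∧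
    (¬ (a = iotaW Sig k ∧ b = iotaW Sig l) →
      ∃ w₁ w₂ w', SilentStar L w w₁ ∧ L.Trans w₁ a b w₂ ∧
        SilentStar L w₂ w' ∧ S v' w')

/-- Weak bisimulation: `S` and its inverse are weak simulations. -/
def IsWeakBisim (L : LTS Sig V k l) (S : V → V → Prop) : Prop :=
  IsWeakSim L S ∧ IsWeakSim L (flip S)

/-- Strong bisimilarity of two states. -/
def StrongBisimilar (L : LTS Sig V k l) (v w : V) : Prop :=
  ∃ S, IsStrongBisim L S ∧ S v w

/-- Weak bisimilarity of two states. -/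
def WeakBisimilar (L : LTS Sig V k l) (v w : V) : Prop :=
  ∃ S, IsWeakBisim L S ∧ S v w

theorem Silent.trans {L : LTS Sig V k l} {v w u : V}
    (h : Silent L v w) (h' : Silent L w u) : Silent L v u :=
  L.iota_trans h h' (L.refl u)

theorem SilentStar.silent {L : LTS Sig V k l} {v w : V}
    (h : SilentStar L v w) : Silent L v w := by
  induction h with
  | refl => exact L.refl v
  | tail _ hstep ih => exact ih.trans hstep

theorem IsWeakSim.isStrongSim {L : LTS Sig V k l} {S : V → V → Prop}
    (h : IsWeakSim L S) : IsStrongSim L S := by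
  intro v w hvw a b v' ht
  obtain ⟨hsilent, hvisible⟩ := h v w hvw a b v' ht
  by_cases hab : a = iotaW Sig k ∧ b = iotaW Sig l
  · obtain ⟨w', hw, hS⟩ := hsilent hab
    obtain ⟨rfl, rfl⟩ := hab
    exact ⟨w', hw.silent, hS⟩
  · obtain ⟨w₁, w₂, w', h₁, h₂, h₃, hS⟩ := hvisible hab
    exact ⟨w', L.iota_trans h₁.silent h₂ h₃.silent, hS⟩

theorem IsStrongSim.isWeakSim {L : LTS Sig V k l} {S : V → V → Prop}
    (h : IsStrongSim L S) : IsWeakSim L S := by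
  intro v w hvw a b v' ht
  obtain ⟨w', hw, hS⟩ := h v w hvw a b v' ht
  refine ⟨?_, fun _ => ⟨w, w', w', .refl, hw, .refl, hS⟩⟩
  rintro ⟨rfl, rfl⟩
  exact ⟨w', .single hw, hS⟩

theorem isWeakBisim_iff_isStrongBisim {L : LTS Sig V k l} {S : V → V → Prop} :
    IsWeakBisim L S ↔ IsStrongBisim L S :=
  ⟨fun h => ⟨h.1.isStrongSim, h.2.isStrongSim⟩, fun h => ⟨h.1.isWeakSim, h.2.isWeakSim⟩⟩

/-- On a reflexive and ι-transitive LTS, every weak bisimulation is a strong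
bisimulation; consequently weak bisimilarity coincides with strong
bisimilarity. -/
theorem weak_bisim_eq_strong_bisim (L : LTS Sig V k l) :
    (∀ S : V → V → Prop, IsWeakBisim L S → IsStrongBisim L S) ∧
    (∀ v w : V, WeakBisimilar L v w ↔ StrongBisimilar L v w) :=
  ⟨fun _ => isWeakBisim_iff_isStrongBisim.mp, fun _ _ =>
    exists_congr fun _ => and_congr_left' isWeakBisim_iff_isStrongBisim⟩

end Stmt0
end

section
/- Let P : (k,l) and Q : (m,n) be closed sorted terms of the wire calculus. If P⊗Q →[a⃗/b⃗] R is a transition of the operational semantics, then R = P′⊗Q′ and there exist single transitions P →[a⃗₁/b⃗₁] P′ and Q →[a⃗₂/b⃗₂] Q′ with a⃗ = a⃗₁a⃗₂ and b⃗ = b⃗₁b⃗₂ (concatenation of words). -/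
/-!
# The wire calculus

Signals are drawn from an alphabet `Sig`; a label letter is `Option Sig`,
where `none` represents `ι` (absence of signal) and `some σ` a signal `σ ∈ Σ`.
Labels of transitions are pairs of words (lists) of such letters.
-/

namespace WireCalc

/-- Prefix atoms. `fvar n` is a free occurrence of the signal variable `n`,
`bvar n` is a binding occurrence `λn`, and `const a` is a constant:
`const none` is `ι` and `const (some σ)` is the signal `σ ∈ Σ`. -/
inductive Atom (Sig : Type) : Type
  | fvar : ℕ → Atom Sig
  | bvar : ℕ → Atom Sig
  | const : Option Sig → Atom Sig

/-- Wire calculus terms. Process variables are de Bruijn indices;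
`mu k l P` is `μY:(k,l).P`, binding index `0` in `P`.
`pre u v P` is the prefix `u/v.P`. -/
inductive Term (Sig : Type) : Type
  | pvar : ℕ → Term Sig
  | seq : Term Sig → Term Sig → Term Sig
  | ten : Term Sig → Term Sig → Term Sig
  | pre : List (Atom Sig) → List (Atom Sig) → Term Sig → Term Sig
  | choice : Term Sig → Term Sig → Term Sig
  | mu : ℕ → ℕ → Term Sig → Term Sig

variable {Sig : Type}

def Atom.isBindOf (n : ℕ) : Atom Sig → Bool
  | .bvar m => m = n
  | _ => false

def Atom.isFreeOf (n : ℕ) : Atom Sig → Bool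
  | .fvar m => m = n
  | _ => false

def Atom.isFvar : Atom Sig → Bool
  | .fvar _ => true
  | _ => false

/-- The signal variable `n` is bound by the prefix `u/v`
(i.e. `λn` occurs in `uv`). -/
def boundIn (n : ℕ) (u v : List (Atom Sig)) : Bool := (u ++ v).any (Atom.isBindOf n)

/-- The signal variable `n` occurs freely in the prefix `u/v`. -/
def freeIn (n : ℕ) (u v : List (Atom Sig)) : Bool := (u ++ v).any (Atom.isFreeOf n)

/-- `bd(u/v)`: the set of signal variables bound by the prefix `u/v`. -/
def bdSet (u v : List (Atom Sig)) : Set ℕ := {n | boundIn n u v}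

/-- `fr(u/v)`: the set of signal variables occurring freely in the prefix `u/v`. -/
def frSet (u v : List (Atom Sig)) : Set ℕ := {n | freeIn n u v}

/-- Substitution of constants for free signal variables in an atom.
`σ n = some a` means `n` is replaced by the constant `a`. -/
def Atom.substS (σ : ℕ → Option (Option Sig)) : Atom Sig → Atom Sig
  | .fvar n =>
      match σ n with
      | some a => .const a
      | none => .fvar n
  | .bvar n => .bvar n
  | .const a => .const a

/-- Substitution of constants for free signal variables in a term;
variables bound by an inner prefix are shadowed and not substituted
under that prefix. -/
def Term.substS (σ : ℕ → Option (Option Sig)) : Term Sig → Term Sig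
  | .pvar i => .pvar i
  | .seq P Q => .seq (P.substS σ) (Q.substS σ)
  | .ten P Q => .ten (P.substS σ) (Q.substS σ)
  | .pre u v P => .pre (u.map (Atom.substS σ)) (v.map (Atom.substS σ))
      (P.substS fun n => if boundIn n u v then none else σ n)
  | .choice P Q => .choice (P.substS σ) (Q.substS σ)
  | .mu k l P => .mu k l (P.substS σ)

/-- Shifting of process variables `≥ c` by `d` (standard de Bruijn machinery). -/
def shiftP (d : ℕ) : ℕ → Term Sig → Term Sig
  | c, .pvar i => .pvar (if c ≤ i then i + d else i)
  | c, .seq P Q => .seq (shiftP d c P) (shiftP d c Q)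
  | c, .ten P Q => .ten (shiftP d c P) (shiftP d c Q)
  | c, .pre u v P => .pre u v (shiftP d c P)
  | c, .choice P Q => .choice (shiftP d c P) (shiftP d c Q)
  | c, .mu k l P => .mu k l (shiftP d (c + 1) P)

/-- Capture-avoiding substitution `substP j S P = P[S / (pvar j)]` of a term
for a process variable. -/
def substP : ℕ → Term Sig → Term Sig → Term Sig
  | j, S, .pvar i => if i = j then S else if j < i then .pvar (i - 1) else .pvar i
  | j, S, .seq P Q => .seq (substP j S P) (substP j S Q)
  | j, S, .ten P Q => .ten (substP j S P) (substP j S Q)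
  | j, S, .pre u v P => .pre u v (substP j S P)
  | j, S, .choice P Q => .choice (substP j S P) (substP j S Q)
  | j, S, .mu k l P => .mu k l (substP (j + 1) (shiftP 1 0 S) P)

/-- The sorting judgement `Sorted Γ Δ P k l`, i.e. `Γ; Δ ⊢ P : (k, l)`,
where `Γ` is the (de Bruijn) context of process variables with their sorts
and `Δ` the set of signal variables in scope. -/
inductive Sorted : List (ℕ × ℕ) → Set ℕ → Term Sig → ℕ → ℕ → Prop
  | pvar {Γ : List (ℕ × ℕ)} {Δ : Set ℕ} {i k l} :
      Γ[i]? = some (k, l) → Sorted Γ Δ (.pvar i) k l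
  | seq {Γ Δ P Q k n l} : Sorted Γ Δ P k n → Sorted Γ Δ Q n l →
      Sorted Γ Δ (.seq P Q) k l
  | ten {Γ Δ P Q k l m n} : Sorted Γ Δ P k l → Sorted Γ Δ Q m n →
      Sorted Γ Δ (.ten P Q) (k + m) (l + n)
  | pre {Γ Δ u v P k l} : u.length = k → v.length = l →
      frSet u v ∩ bdSet u v = ∅ → frSet u v ⊆ Δ →
      Sorted Γ (Δ ∪ bdSet u v) P k l → Sorted Γ Δ (.pre u v P) k l
  | choice {Γ Δ P Q k l} : Sorted Γ Δ P k l → Sorted Γ Δ Q k l →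
      Sorted Γ Δ (.choice P Q) k l
  | mu {Γ Δ P k' l' k l} : Sorted ((k', l') :: Γ) Δ P k l →
      Sorted Γ Δ (.mu k' l' P) k l

/-- The word `ι⃗` of length `k`, consisting solely of `ι`'s. -/
def iotaW (Sig : Type) (k : ℕ) : List (Option Sig) := List.replicate k none

/-- A word consists solely of `ι`'s. -/
def IsIota (w : List (Option Sig)) : Prop := ∀ x ∈ w, x = none

/-- Instantiation of a prefix atom to a label letter along a substitution `σ`
of the bound signal variables. -/
def instAtom (σ : ℕ → Option Sig) : Atom Sig → Option Sig
  | .fvar n => σ n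
  | .bvar n => σ n
  | .const a => a

/-- The operational semantics of the wire calculus: `Step P a b Q` means
`P →[a/b] Q`.  The rules are Refl, ιL, ιR, Cut, Ten, Pref, +ι, +L, +R, Rec. -/
inductive Step : Term Sig → List (Option Sig) → List (Option Sig) → Term Sig → Prop
  | refl {P : Term Sig} {k l : ℕ} :
      Sorted [] ∅ P k l → Step P (iotaW Sig k) (iotaW Sig l) P
  | iotaL {P R Q : Term Sig} {a' b' a b} :
      IsIota a' → IsIota b' → Step P a' b' R → Step R a b Q → Step P a b Q
  | iotaR {P R Q : Term Sig} {a b a' b'} :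
      Step P a b R → IsIota a' → IsIota b' → Step R a' b' Q → Step P a b Q
  | cut {P Q R S : Term Sig} {a b c} :
      Step P a c Q → Step R c b S → Step (.seq P R) a b (.seq Q S)
  | ten {P Q R S : Term Sig} {a b c d} :
      Step P a b Q → Step R c d S → Step (.ten P R) (a ++ c) (b ++ d) (.ten Q S)
  | pref {u v : List (Atom Sig)} {P : Term Sig} (σ : ℕ → Option Sig)
      (hnofree : ∀ x ∈ u ++ v, x.isFvar = false) :
      Step (.pre u v P) (u.map (instAtom σ)) (v.map (instAtom σ))
        (P.substS fun n => if boundIn n u v then some (σ n) else none)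
  | choiceIota {P Q R S : Term Sig} {a b} :
      IsIota a → IsIota b → Step P a b Q → Step R a b S →
      Step (.choice P R) a b (.choice Q S)
  | choiceL {P Q R : Term Sig} {a b} :
      ¬ IsIota (a ++ b) → Step P a b Q → Step (.choice P R) a b Q
  | choiceR {P Q R : Term Sig} {a b} :
      ¬ IsIota (a ++ b) → Step R a b Q → Step (.choice P R) a b Q
  | recur {k l : ℕ} {P Q : Term Sig} {a b} :
      Step (substP 0 (.mu k l P) P) a b Q → Step (.mu k l P) a b Q

/-- A chain of transitions with the given list of labels. -/
inductive MultiStep :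
    Term Sig → List (List (Option Sig) × List (Option Sig)) → Term Sig → Prop
  | nil (P : Term Sig) : MultiStep P [] P
  | cons {P Q R : Term Sig} {a b ls} :
      Step P a b Q → MultiStep Q ls R → MultiStep P ((a, b) :: ls) R

/-- `S` is a simulation on the LTS of the wire calculus. -/
def IsSim (S : Term Sig → Term Sig → Prop) : Prop :=
  ∀ P Q, S P Q → ∀ a b P', Step P a b P' → ∃ Q', Step Q a b Q' ∧ S P' Q'

/-- (Strong) bisimilarity `P ∼ Q` of wire calculus terms: some relation
containing `(P, Q)` is a bisimulation, i.e. it and its inverse are simulations. -/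
def Bisim (P Q : Term Sig) : Prop :=
  ∃ S : Term Sig → Term Sig → Prop, IsSim S ∧ IsSim (flip S) ∧ S P Q

/-! ## Wire constants -/

/-- The word of binders `λx₁…λxₘ`. -/
def bindW (Sig : Type) (m : ℕ) : List (Atom Sig) := (List.range m).map Atom.bvar

/-- The `m`-fold identity wire `Iₘ := μY.(λx₁…λxₘ/λx₁…λxₘ).Y : (m,m)`. -/
def idW (Sig : Type) (m : ℕ) : Term Sig :=
  .mu m m (.pre (bindW Sig m) (bindW Sig m) (.pvar 0))

/-- The symmetry (twist) wire
`X_{k,l} := μY.(λx₁…λxₖλy₁…λyₗ / λy₁…λyₗλx₁…λxₖ).Y : (k+l, l+k)`. -/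
def twistW (Sig : Type) (k l : ℕ) : Term Sig :=
  .mu (k + l) (l + k)
    (.pre (bindW Sig k ++ ((List.range l).map fun i => Atom.bvar (k + i)))
          (((List.range l).map fun i => Atom.bvar (k + i)) ++ bindW Sig k)
          (.pvar 0))

/-- The wire constant `d := μY.(ε/λxλx).Y : (0,2)`. -/
def dW (Sig : Type) : Term Sig := .mu 0 2 (.pre [] [.bvar 0, .bvar 0] (.pvar 0))

/-- The wire constant `e := μY.(λxλx/ε).Y : (2,0)`. -/
def eW (Sig : Type) : Term Sig := .mu 2 0 (.pre [.bvar 0, .bvar 0] [] (.pvar 0))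

/-- The trivial term `0 := μY.Y : (0,0)`. -/
def zeroW (Sig : Type) : Term Sig := .mu 0 0 (.pvar 0)

/-- `dₙ : (0,2n)`, recursively: `d₀ := 0`, `d₁ := d`, `d_{n+1} := d;(I⊗dₙ⊗I)`. -/
def dN (Sig : Type) : ℕ → Term Sig
  | 0 => zeroW Sig
  | 1 => dW Sig
  | n + 2 => .seq (dW Sig) (.ten (.ten (idW Sig 1) (dN Sig (n + 1))) (idW Sig 1))

/-- `eₙ : (2n,0)`, recursively: `e₀ := 0`, `e₁ := e`, `e_{n+1} := (Iₙ⊗e⊗Iₙ);eₙ`. -/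
def eN (Sig : Type) : ℕ → Term Sig
  | 0 => zeroW Sig
  | 1 => eW Sig
  | n + 2 => .seq (.ten (.ten (idW Sig (n + 1)) (eW Sig)) (idW Sig (n + 1)))
      (eN Sig (n + 1))

/-- `Iₙ` with the convention `I₀ := 0`. -/
def IN (Sig : Type) : ℕ → Term Sig
  | 0 => zeroW Sig
  | n + 1 => idW Sig (n + 1)

/-- The dualizing transformation `(-)*`; on prefix strings it is reversal. -/
def Term.star : Term Sig → Term Sig
  | .pvar i => .pvar i
  | .seq P Q => .seq Q.star P.star
  | .ten P Q => .ten Q.star P.star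
  | .pre u v P => .pre v.reverse u.reverse P.star
  | .choice P Q => .choice P.star Q.star
  | .mu k l P => .mu l k P.star

end WireCalc

namespace WireCalc

theorem IsIota.of_append {Sig : Type} {u v : List (Option Sig)} (h : IsIota (u ++ v)) :
    IsIota u ∧ IsIota v :=
  ⟨fun x hx => h x (List.mem_append_left v hx), fun x hx => h x (List.mem_append_right u hx)⟩

/-- Every transition of a tensor splits into transitions of its components;
no sorting assumption is needed. -/
theorem Step.ten_inv {Sig : Type} {T R : Term Sig} {a b : List (Option Sig)}
    (h : Step T a b R) : ∀ P Q : Term Sig, T = .ten P Q →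
    ∃ (P' Q' : Term Sig) (a₁ b₁ a₂ b₂ : List (Option Sig)),
      R = .ten P' Q' ∧ Step P a₁ b₁ P' ∧ Step Q a₂ b₂ Q' ∧
      a = a₁ ++ a₂ ∧ b = b₁ ++ b₂ := by
  induction h with
  | refl hs =>
    rintro P Q rfl
    cases hs with
    | ten hP hQ =>
      exact ⟨P, Q, _, _, _, _, rfl, .refl hP, .refl hQ,
        List.replicate_add .., List.replicate_add ..⟩
  | iotaL ha hb _ _ ih₁ ih₂ =>
    intro P Q hT
    obtain ⟨P₁, Q₁, _, _, _, _, hR, hP₁, hQ₁, rfl, rfl⟩ := ih₁ P Q hT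
    obtain ⟨P₂, Q₂, _, _, _, _, hR', hP₂, hQ₂, rfl, rfl⟩ := ih₂ P₁ Q₁ hR
    exact ⟨P₂, Q₂, _, _, _, _, hR', .iotaL ha.of_append.1 hb.of_append.1 hP₁ hP₂,
      .iotaL ha.of_append.2 hb.of_append.2 hQ₁ hQ₂, rfl, rfl⟩
  | iotaR _ ha hb _ ih₁ ih₂ =>
    intro P Q hT
    obtain ⟨P₁, Q₁, _, _, _, _, hR, hP₁, hQ₁, rfl, rfl⟩ := ih₁ P Q hT
    obtain ⟨P₂, Q₂, _, _, _, _, hR', hP₂, hQ₂, rfl, rfl⟩ := ih₂ P₁ Q₁ hR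
    exact ⟨P₂, Q₂, _, _, _, _, hR', .iotaR hP₁ ha.of_append.1 hb.of_append.1 hP₂,
      .iotaR hQ₁ ha.of_append.2 hb.of_append.2 hQ₂, rfl, rfl⟩
  | ten hP hQ =>
    intro P Q hT
    cases hT
    exact ⟨_, _, _, _, _, _, rfl, hP, hQ, rfl, rfl⟩
  | _ =>
    intro P Q hT
    cases hT

/-- decomposition of transitions of a tensor `P⊗Q` into single
transitions of `P` and `Q`, whose labels concatenate to the original ones. -/
theorem ten_decomposition {Sig : Type} {P Q R : Term Sig} {k l m n : ℕ}
    {a b : List (Option Sig)}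
    (hP : Sorted [] ∅ P k l) (hQ : Sorted [] ∅ Q m n)
    (h : Step (.ten P Q) a b R) :
    ∃ (P' Q' : Term Sig) (a₁ b₁ a₂ b₂ : List (Option Sig)),
      R = .ten P' Q' ∧ Step P a₁ b₁ P' ∧ Step Q a₂ b₂ Q' ∧
      a = a₁ ++ a₂ ∧ b = b₁ ++ b₂ :=
  h.ten_inv P Q rfl

end WireCalc
end

section
/- Bisimilarity is a congruence for sequential composition in the wire calculus: if P, Q : (k,l), S : (l,l′), T : (k′,k) are closed sorted terms and P ∼ Q, then P;S ∼ Q;S and T;P ∼ T;Q. -/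
namespace WireCalc

theorem Bisim.refl {Sig : Type} (P : Term Sig) : Bisim P P :=
  ⟨Eq, fun _ _ h _ _ P' hs => ⟨P', h ▸ hs, rfl⟩,
    fun _ _ h _ _ P' hs => ⟨P', Eq.symm h ▸ hs, rfl⟩, rfl⟩

theorem Bisim.symm {Sig : Type} {P Q : Term Sig} (h : Bisim P Q) : Bisim Q P := by
  obtain ⟨R, hR, hR', hPQ⟩ := h
  exact ⟨flip R, hR', hR, hPQ⟩

theorem Bisim.step {Sig : Type} {P Q P' : Term Sig} {a b : List (Option Sig)}
    (h : Bisim P Q) (hs : Step P a b P') : ∃ Q', Step Q a b Q' ∧ Bisim P' Q' := by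
  obtain ⟨R, hR, hR', hPQ⟩ := h
  obtain ⟨Q', hQ', hr⟩ := hR _ _ hPQ _ _ _ hs
  exact ⟨Q', hQ', R, hR, hR', hr⟩

/-- Two sequential compositions of componentwise bisimilar terms. -/
def SeqBisim {Sig : Type} (U V : Term Sig) : Prop :=
  ∃ P Q R S : Term Sig, U = .seq P R ∧ V = .seq Q S ∧ Bisim P Q ∧ Bisim R S

theorem SeqBisim.symm {Sig : Type} {U V : Term Sig} (h : SeqBisim U V) : SeqBisim V U := by
  obtain ⟨P, Q, R, S, rfl, rfl, hPQ, hRS⟩ := h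
  exact ⟨Q, P, S, R, rfl, rfl, hPQ.symm, hRS.symm⟩

theorem SeqBisim.step {Sig : Type} {U U' : Term Sig} {a b : List (Option Sig)}
    (hs : Step U a b U') :
    ∀ {V : Term Sig}, SeqBisim U V → ∃ V', Step V a b V' ∧ SeqBisim U' V' := by
  induction hs with
  | refl hsort =>
    rintro V ⟨P, Q, R, S, rfl, rfl, hPQ, hRS⟩
    cases hsort with
    | seq hP hR =>
      obtain ⟨Q', hQ', hPQ'⟩ := hPQ.step (Step.refl hP)
      obtain ⟨S', hS', hRS'⟩ := hRS.step (Step.refl hR)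
      exact ⟨_, .cut hQ' hS', _, _, _, _, rfl, rfl, hPQ', hRS'⟩
  | iotaL ha hb _ _ ih₁ ih₂ =>
    intro V hV
    obtain ⟨W, hW, hW'⟩ := ih₁ hV
    obtain ⟨X, hX, hX'⟩ := ih₂ hW'
    exact ⟨X, .iotaL ha hb hW hX, hX'⟩
  | iotaR _ ha hb _ ih₁ ih₂ =>
    intro V hV
    obtain ⟨W, hW, hW'⟩ := ih₁ hV
    obtain ⟨X, hX, hX'⟩ := ih₂ hW'
    exact ⟨X, .iotaR hW ha hb hX, hX'⟩
  | cut hP hR =>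
    rintro V ⟨P, Q, R, S, hU, rfl, hPQ, hRS⟩
    cases hU
    obtain ⟨Q', hQ', hPQ'⟩ := hPQ.step hP
    obtain ⟨S', hS', hRS'⟩ := hRS.step hR
    exact ⟨_, .cut hQ' hS', _, _, _, _, rfl, rfl, hPQ', hRS'⟩
  | _ =>
    rintro V ⟨P, Q, R, S, hU, -⟩
    cases hU

/-- Sequential composition preserves bisimilarity in both arguments at once. -/
theorem Bisim.seq {Sig : Type} {P Q R S : Term Sig} (hPQ : Bisim P Q) (hRS : Bisim R S) :
    Bisim (.seq P R) (.seq Q S) := by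
  refine ⟨SeqBisim, fun _ _ h _ _ _ hs => SeqBisim.step hs h, fun _ _ h _ _ _ hs => ?_,
    P, Q, R, S, rfl, rfl, hPQ, hRS⟩
  obtain ⟨V, hV, hV'⟩ := SeqBisim.step hs (SeqBisim.symm h)
  exact ⟨V, hV, hV'.symm⟩

/-- bisimilarity is a congruence for sequential composition. -/
theorem bisim_congr_seq {Sig : Type} {P Q S T : Term Sig} {k l l' k' : ℕ}
    (hP : Sorted [] ∅ P k l) (hQ : Sorted [] ∅ Q k l)
    (hS : Sorted [] ∅ S l l') (hT : Sorted [] ∅ T k' k)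
    (h : Bisim P Q) :
    Bisim (.seq P S) (.seq Q S) ∧ Bisim (.seq T P) (.seq T Q) := by
  exact ⟨h.seq (.refl S), Bisim.seq (.refl T) h⟩

end WireCalc
end

section
/- The symmetry wires of the wire calculus are self-inverse up to bisimilarity: for all k,l ∈ ℕ, X_{k,l};X_{l,k} ∼ I_{k+l}, where X_{k,l} is the symmetry wire of sort (k+l, l+k) and I_{k+l} the identity wire of sort (k+l, k+l). -/
namespace WireCalc

/-- The term `μY:(m,n).(u/v).Y` offering the single prefix `u/v` forever. -/
def wire {Sig : Type} (m n : ℕ) (u v : List (Atom Sig)) : Term Sig :=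
  .mu m n (.pre u v (.pvar 0))

/-- The states of `wire m n u v`: the recursive term itself and its unfolding. -/
def IsWireState {Sig : Type} (m n : ℕ) (u v : List (Atom Sig)) (P : Term Sig) : Prop :=
  P = wire m n u v ∨ P = .pre u v (wire m n u v)

/-- Every letter of the word is a binder. -/
def AllBinders {Sig : Type} (u : List (Atom Sig)) : Prop := ∀ x ∈ u, ∃ i, x = .bvar i

section Wire

variable {Sig : Type} {m n : ℕ} {u v : List (Atom Sig)}

theorem AllBinders.map_substS (hu : AllBinders u) (σ : ℕ → Option (Option Sig)) :
    u.map (Atom.substS σ) = u := by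
  conv_rhs => rw [← List.map_id u]
  refine List.map_congr_left fun x hx => ?_
  obtain ⟨i, rfl⟩ := hu x hx
  rfl

theorem AllBinders.map_instAtom_none (hu : AllBinders u) :
    u.map (instAtom fun _ => none) = iotaW Sig u.length := by
  rw [iotaW, ← List.map_const']
  refine List.map_congr_left fun x hx => ?_
  obtain ⟨i, rfl⟩ := hu x hx
  rfl

theorem wire_substS (hu : AllBinders u) (hv : AllBinders v) (σ : ℕ → Option (Option Sig)) :
    (wire m n u v).substS σ = wire m n u v := by
  simp [wire, Term.substS, hu.map_substS, hv.map_substS]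

theorem substP_wire_body :
    substP 0 (wire m n u v) (.pre u v (.pvar 0)) = .pre u v (wire m n u v) := by
  simp [substP]

theorem IsWireState.sorted_length {P : Term Sig} {Γ : List (ℕ × ℕ)} {Δ : Set ℕ} {k l : ℕ}
    (hP : IsWireState m n u v P) (h : Sorted Γ Δ P k l) : u.length = k ∧ v.length = l := by
  rcases hP with rfl | rfl
  · cases h with
    | mu h => cases h with | pre hk hl => exact ⟨hk, hl⟩
  · cases h with
    | pre hk hl => exact ⟨hk, hl⟩

theorem IsWireState.of_step (hu : AllBinders u) (hv : AllBinders v) {P Q : Term Sig}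
    {a b : List (Option Sig)} (hP : IsWireState m n u v P) (h : Step P a b Q) :
    IsWireState m n u v Q ∧ ∃ σ : ℕ → Option Sig,
      a = u.map (instAtom σ) ∧ b = v.map (instAtom σ) := by
  induction h with
  | refl hs =>
    obtain ⟨rfl, rfl⟩ := hP.sorted_length hs
    exact ⟨hP, fun _ => none, hu.map_instAtom_none.symm, hv.map_instAtom_none.symm⟩
  | iotaL _ _ _ _ ih₁ ih₂ => exact ih₂ (ih₁ hP).1
  | iotaR _ _ _ _ ih₁ ih₂ => exact ⟨(ih₂ (ih₁ hP).1).1, (ih₁ hP).2⟩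
  | pref σ _ =>
    rcases hP with h | h
    · cases h
    · cases h
      exact ⟨Or.inl (wire_substS hu hv _), σ, rfl, rfl⟩
  | recur _ ih =>
    rcases hP with h | h
    · cases h
      exact ih (Or.inr substP_wire_body)
    · cases h
  | cut => rcases hP with h | h <;> cases h
  | ten => rcases hP with h | h <;> cases h
  | choiceIota => rcases hP with h | h <;> cases h
  | choiceL => rcases hP with h | h <;> cases h
  | choiceR => rcases hP with h | h <;> cases h

theorem IsWireState.step (hu : AllBinders u) (hv : AllBinders v) {P : Term Sig}
    (hP : IsWireState m n u v P) (σ : ℕ → Option Sig) :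
    Step P (u.map (instAtom σ)) (v.map (instAtom σ)) (wire m n u v) := by
  have hpre : Step (.pre u v (wire m n u v)) (u.map (instAtom σ)) (v.map (instAtom σ))
      (wire m n u v) := by
    have h := Step.pref (u := u) (v := v) (P := wire m n u v) σ (by
      intro x hx
      obtain ⟨i, rfl⟩ := (List.mem_append.mp hx).elim (hu x) (hv x)
      rfl)
    rwa [wire_substS hu hv] at h
  rcases hP with rfl | rfl
  · refine Step.recur ?_
    rw [← wire, substP_wire_body]
    exact hpre
  · exact hpre

end Wire

/-- The word `λx₁…λxₖλy₁…λyₗ`, the left boundary of `X_{k,l}`. -/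
def twistL (Sig : Type) (k l : ℕ) : List (Atom Sig) :=
  bindW Sig k ++ (List.range l).map fun i => Atom.bvar (k + i)

/-- The word `λy₁…λyₗλx₁…λxₖ`, the right boundary of `X_{k,l}`. -/
def twistR (Sig : Type) (k l : ℕ) : List (Atom Sig) :=
  ((List.range l).map fun i => Atom.bvar (k + i)) ++ bindW Sig k

section Twist

variable {Sig : Type} {k l m : ℕ}

theorem allBinders_bindW : AllBinders (bindW Sig m) := by
  intro x hx
  simp only [bindW, List.mem_map] at hx
  obtain ⟨i, -, rfl⟩ := hx
  exact ⟨i, rfl⟩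

theorem allBinders_twistL : AllBinders (twistL Sig k l) := by
  intro x hx
  simp only [twistL, bindW, List.mem_append, List.mem_map] at hx
  obtain ⟨i, -, rfl⟩ | ⟨i, -, rfl⟩ := hx <;> exact ⟨_, rfl⟩

theorem allBinders_twistR : AllBinders (twistR Sig k l) := by
  intro x hx
  simp only [twistR, bindW, List.mem_append, List.mem_map] at hx
  obtain ⟨i, -, rfl⟩ | ⟨i, -, rfl⟩ := hx <;> exact ⟨_, rfl⟩

theorem map_instAtom_bindW (σ : ℕ → Option Sig) :
    (bindW Sig m).map (instAtom σ) = (List.range m).map σ := by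
  simp [bindW, Function.comp_def, instAtom]

theorem map_instAtom_twistL (σ : ℕ → Option Sig) :
    (twistL Sig k l).map (instAtom σ) =
      (List.range k).map σ ++ (List.range l).map fun i => σ (k + i) := by
  simp [twistL, bindW, Function.comp_def, instAtom]

theorem map_instAtom_twistR (σ : ℕ → Option Sig) :
    (twistR Sig k l).map (instAtom σ) =
      ((List.range l).map fun i => σ (k + i)) ++ (List.range k).map σ := by
  simp [twistR, bindW, Function.comp_def, instAtom]

/-- The states of the identity wire `Iₘ`. -/
def IsIdState (m : ℕ) (P : Term Sig) : Prop :=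
  IsWireState m m (bindW Sig m) (bindW Sig m) P

/-- The states of the symmetry wire `X_{k,l}`. -/
def IsTwistState (k l : ℕ) (P : Term Sig) : Prop :=
  IsWireState (k + l) (l + k) (twistL Sig k l) (twistR Sig k l) P

theorem isIdState_idW : IsIdState m (idW Sig m) := Or.inl rfl

theorem isTwistState_twistW : IsTwistState k l (twistW Sig k l) := Or.inl rfl

theorem exists_map_range_eq (a : List (Option Sig)) :
    ∃ σ : ℕ → Option Sig, (List.range a.length).map σ = a :=
  ⟨fun i => a.getD i none, List.ext_getElem (by simp) fun i h₁ h₂ => by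
    simp [List.getElem?_eq_getElem h₂]⟩

theorem IsIdState.of_step {P Q : Term Sig} {a b : List (Option Sig)} (hP : IsIdState m P)
    (h : Step P a b Q) : IsIdState m Q ∧ a = b ∧ a.length = m := by
  obtain ⟨hQ, σ, rfl, rfl⟩ := IsWireState.of_step allBinders_bindW allBinders_bindW hP h
  exact ⟨hQ, rfl, by simp [bindW]⟩

theorem IsIdState.step {P : Term Sig} {a : List (Option Sig)} (hP : IsIdState m P)
    (ha : a.length = m) : Step P a a (idW Sig m) := by
  obtain ⟨σ, hσ⟩ := exists_map_range_eq a
  have h := IsWireState.step allBinders_bindW allBinders_bindW hP σ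
  rwa [map_instAtom_bindW, ← ha, hσ, ha] at h

theorem IsTwistState.of_step {P Q : Term Sig} {a b : List (Option Sig)}
    (hP : IsTwistState k l P) (h : Step P a b Q) :
    IsTwistState k l Q ∧ ∃ x y, x.length = k ∧ y.length = l ∧ a = x ++ y ∧ b = y ++ x := by
  obtain ⟨hQ, σ, rfl, rfl⟩ := IsWireState.of_step allBinders_twistL allBinders_twistR hP h
  exact ⟨hQ, _, _, by simp, by simp, map_instAtom_twistL σ, map_instAtom_twistR σ⟩

theorem IsTwistState.step {P : Term Sig} {x y : List (Option Sig)} (hP : IsTwistState k l P)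
    (hx : x.length = k) (hy : y.length = l) :
    Step P (x ++ y) (y ++ x) (twistW Sig k l) := by
  obtain ⟨σ, hσ⟩ := exists_map_range_eq (x ++ y)
  have h := IsWireState.step allBinders_twistL allBinders_twistR hP σ
  rw [List.length_append, hx, hy, List.range_add, List.map_append, List.map_map] at hσ
  obtain ⟨h₁, h₂⟩ := List.append_inj hσ (by simp [hx])
  simp only [Function.comp_def] at h₂
  rwa [map_instAtom_twistL, map_instAtom_twistR, h₁, h₂] at h

/-- The states of `X_{k,l};X_{l,k}`. -/
def IsTwistTwistState (k l : ℕ) (P : Term Sig) : Prop :=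
  ∃ A B, P = .seq A B ∧ IsTwistState k l A ∧ IsTwistState l k B

theorem isTwistTwistState_seq_twistW :
    IsTwistTwistState k l (.seq (twistW Sig k l) (twistW Sig l k)) :=
  ⟨_, _, rfl, isTwistState_twistW, isTwistState_twistW⟩

theorem IsTwistTwistState.sorted_length {P : Term Sig} {Γ : List (ℕ × ℕ)} {Δ : Set ℕ}
    {m n : ℕ} (hP : IsTwistTwistState k l P) (h : Sorted Γ Δ P m n) :
    m = k + l ∧ n = k + l := by
  obtain ⟨A, B, rfl, hA, hB⟩ := hP
  cases h with
  | seq h₁ h₂ =>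
    obtain ⟨rfl, -⟩ := IsWireState.sorted_length hA h₁
    obtain ⟨-, rfl⟩ := IsWireState.sorted_length hB h₂
    simp [twistL, twistR, bindW]

theorem IsTwistTwistState.of_step {P Q : Term Sig} {a b : List (Option Sig)}
    (hP : IsTwistTwistState k l P) (h : Step P a b Q) :
    IsTwistTwistState k l Q ∧ a = b ∧ a.length = k + l := by
  induction h with
  | refl hs =>
    obtain ⟨rfl, rfl⟩ := hP.sorted_length hs
    exact ⟨hP, rfl, by simp [iotaW]⟩
  | iotaL _ _ _ _ ih₁ ih₂ => exact ih₂ (ih₁ hP).1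
  | iotaR _ _ _ _ ih₁ ih₂ => exact ⟨(ih₂ (ih₁ hP).1).1, (ih₁ hP).2⟩
  | cut h₁ h₂ =>
    obtain ⟨A, B, h, hA, hB⟩ := hP
    cases h
    obtain ⟨hQ, x, y, hx, hy, rfl, rfl⟩ := hA.of_step h₁
    obtain ⟨hS, y', x', hy', -, hc, rfl⟩ := hB.of_step h₂
    obtain ⟨rfl, rfl⟩ := List.append_inj hc (by rw [hy, hy'])
    exact ⟨⟨_, _, rfl, hQ, hS⟩, rfl, by simp [hx, hy]⟩
  | ten => obtain ⟨_, _, h, -⟩ := hP; cases h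
  | pref => obtain ⟨_, _, h, -⟩ := hP; cases h
  | choiceIota => obtain ⟨_, _, h, -⟩ := hP; cases h
  | choiceL => obtain ⟨_, _, h, -⟩ := hP; cases h
  | choiceR => obtain ⟨_, _, h, -⟩ := hP; cases h
  | recur => obtain ⟨_, _, h, -⟩ := hP; cases h

theorem IsTwistTwistState.step {P : Term Sig} {a : List (Option Sig)}
    (hP : IsTwistTwistState k l P) (ha : a.length = k + l) :
    Step P a a (.seq (twistW Sig k l) (twistW Sig l k)) := by
  obtain ⟨A, B, rfl, hA, hB⟩ := hP
  have hx : (a.take k).length = k := by simp [ha]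
  have hy : (a.drop k).length = l := by simp [ha]
  have h := Step.cut (hA.step hx hy) (hB.step hy hx)
  rwa [List.take_append_drop] at h

end Twist

/-- the symmetry wires are self-inverse up to bisimilarity:
`X_{k,l};X_{l,k} ∼ I_{k+l}`. -/
theorem twist_twist (Sig : Type) (k l : ℕ) :
    Bisim (.seq (twistW Sig k l) (twistW Sig l k)) (idW Sig (k + l)) := by
  refine ⟨fun P Q => IsTwistTwistState k l P ∧ IsIdState (k + l) Q, ?_, ?_,
    isTwistTwistState_seq_twistW, isIdState_idW⟩
  · rintro P Q ⟨hP, hQ⟩ a b P' h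
    obtain ⟨hP', rfl, ha⟩ := hP.of_step h
    exact ⟨_, hQ.step ha, hP', isIdState_idW⟩
  · rintro Q P ⟨hP, hQ⟩ a b Q' h
    obtain ⟨hQ', rfl, ha⟩ := hQ.of_step h
    exact ⟨_, hP.step ha, isTwistTwistState_seq_twistW, hQ'⟩

end WireCalc
end

section
/- The snake (triangle) equations hold for single wires up to bisimilarity: (d⊗I);(I⊗e) ∼ I and (I⊗d);(e⊗I) ∼ I, where I : (1,1) is the identity wire, d := μY.(ε / λxλx).Y : (0,2) and e := μY.(λxλx / ε).Y : (2,0). -/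
namespace WireCalc

/-- The set of states `K` is closed under transitions, and each of its states
offers exactly the labels in `L`. -/
structure Behaves {Sig : Type} (K : Term Sig → Prop)
    (L : List (Option Sig) → List (Option Sig) → Prop) : Prop where
  sound : ∀ {P a b Q}, Step P a b Q → K P → L a b ∧ K Q
  complete : ∀ {P a b}, K P → L a b → ∃ Q, Step P a b Q ∧ K Q

theorem Behaves.bisim {Sig : Type} {K K' : Term Sig → Prop}
    {L : List (Option Sig) → List (Option Sig) → Prop}
    (h : Behaves K L) (h' : Behaves K' L) {P Q : Term Sig} (hP : K P) (hQ : K' Q) :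
    Bisim P Q := by
  refine ⟨fun P Q => K P ∧ K' Q, ?_, ?_, hP, hQ⟩
  · rintro P Q ⟨hP, hQ⟩ a b P' hs
    obtain ⟨hl, hP'⟩ := h.sound hs hP
    obtain ⟨Q', hs', hQ'⟩ := h'.complete hQ hl
    exact ⟨Q', hs', hP', hQ'⟩
  · rintro Q P ⟨hP, hQ⟩ a b Q' hs
    obtain ⟨hl, hQ'⟩ := h'.sound hs hQ
    obtain ⟨P', hs', hP'⟩ := h.complete hP hl
    exact ⟨P', hs', hP', hQ'⟩

theorem Behaves.congr {Sig : Type} {K : Term Sig → Prop}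
    {L L' : List (Option Sig) → List (Option Sig) → Prop}
    (h : Behaves K L) (hL : ∀ a b, L a b ↔ L' a b) : Behaves K L' where
  sound hs hP := ⟨(hL _ _).1 (h.sound hs hP).1, (h.sound hs hP).2⟩
  complete hP hl := h.complete hP ((hL _ _).2 hl)

theorem Behaves.seq {Sig : Type} {K₁ K₂ : Term Sig → Prop}
    {L₁ L₂ : List (Option Sig) → List (Option Sig) → Prop}
    (h₁ : Behaves K₁ L₁) (h₂ : Behaves K₂ L₂) :
    Behaves (fun P => ∃ P₁ P₂, K₁ P₁ ∧ K₂ P₂ ∧ P = .seq P₁ P₂)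
      (fun a b => ∃ c, L₁ a c ∧ L₂ c b) where
  sound := by
    intro P a b Q hs
    induction hs with
    | refl hsort =>
      rintro ⟨P₁, P₂, hP₁, hP₂, rfl⟩
      cases hsort with
      | seq s₁ s₂ =>
        exact ⟨⟨_, (h₁.sound (.refl s₁) hP₁).1, (h₂.sound (.refl s₂) hP₂).1⟩,
          P₁, P₂, hP₁, hP₂, rfl⟩
    | iotaL _ _ _ _ ih₁ ih₂ => exact fun hP => ih₂ (ih₁ hP).2
    | iotaR _ _ _ _ ih₁ ih₂ => exact fun hP => ⟨(ih₁ hP).1, (ih₂ (ih₁ hP).2).2⟩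
    | cut s₁ s₂ =>
      rintro ⟨P₁, P₂, hP₁, hP₂, heq⟩
      cases heq
      exact ⟨⟨_, (h₁.sound s₁ hP₁).1, (h₂.sound s₂ hP₂).1⟩,
        _, _, (h₁.sound s₁ hP₁).2, (h₂.sound s₂ hP₂).2, rfl⟩
    | _ => rintro ⟨_, _, _, _, heq⟩; cases heq
  complete := by
    rintro _ a b ⟨P₁, P₂, hP₁, hP₂, rfl⟩ ⟨c, hl₁, hl₂⟩
    obtain ⟨Q₁, s₁, hQ₁⟩ := h₁.complete hP₁ hl₁
    obtain ⟨Q₂, s₂, hQ₂⟩ := h₂.complete hP₂ hl₂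
    exact ⟨_, .cut s₁ s₂, Q₁, Q₂, hQ₁, hQ₂, rfl⟩

theorem Behaves.ten {Sig : Type} {K₁ K₂ : Term Sig → Prop}
    {L₁ L₂ : List (Option Sig) → List (Option Sig) → Prop}
    (h₁ : Behaves K₁ L₁) (h₂ : Behaves K₂ L₂) :
    Behaves (fun P => ∃ P₁ P₂, K₁ P₁ ∧ K₂ P₂ ∧ P = .ten P₁ P₂)
      (fun a b => ∃ a₁ b₁ a₂ b₂, L₁ a₁ b₁ ∧ L₂ a₂ b₂ ∧ a = a₁ ++ a₂ ∧ b = b₁ ++ b₂) where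
  sound := by
    intro P a b Q hs
    induction hs with
    | refl hsort =>
      rintro ⟨P₁, P₂, hP₁, hP₂, rfl⟩
      cases hsort with
      | ten s₁ s₂ =>
        exact ⟨⟨_, _, _, _, (h₁.sound (.refl s₁) hP₁).1, (h₂.sound (.refl s₂) hP₂).1,
          List.replicate_add .., List.replicate_add ..⟩, P₁, P₂, hP₁, hP₂, rfl⟩
    | iotaL _ _ _ _ ih₁ ih₂ => exact fun hP => ih₂ (ih₁ hP).2
    | iotaR _ _ _ _ ih₁ ih₂ => exact fun hP => ⟨(ih₁ hP).1, (ih₂ (ih₁ hP).2).2⟩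
    | ten s₁ s₂ =>
      rintro ⟨P₁, P₂, hP₁, hP₂, heq⟩
      cases heq
      exact ⟨⟨_, _, _, _, (h₁.sound s₁ hP₁).1, (h₂.sound s₂ hP₂).1, rfl, rfl⟩,
        _, _, (h₁.sound s₁ hP₁).2, (h₂.sound s₂ hP₂).2, rfl⟩
    | _ => rintro ⟨_, _, _, _, heq⟩; cases heq
  complete := by
    rintro _ a b ⟨P₁, P₂, hP₁, hP₂, rfl⟩ ⟨a₁, b₁, a₂, b₂, hl₁, hl₂, rfl, rfl⟩
    obtain ⟨Q₁, s₁, hQ₁⟩ := h₁.complete hP₁ hl₁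
    obtain ⟨Q₂, s₂, hQ₂⟩ := h₂.complete hP₂ hl₂
    exact ⟨_, .ten s₁ s₂, Q₁, Q₂, hQ₁, hQ₂, rfl⟩

/-- The wire `μY.(λx…λx/λx…λx).Y : (m,n)` connecting all its ports. -/
def spider (Sig : Type) (m n : ℕ) : Term Sig :=
  .mu m n (.pre (List.replicate m (.bvar 0)) (List.replicate n (.bvar 0)) (.pvar 0))

/-- The one-step unfolding of `spider`. -/
def spiderUnfold (Sig : Type) (m n : ℕ) : Term Sig :=
  .pre (List.replicate m (.bvar 0)) (List.replicate n (.bvar 0)) (spider Sig m n)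

theorem substS_spider {Sig : Type} (m n : ℕ) (σ : ℕ → Option (Option Sig)) :
    (spider Sig m n).substS σ = spider Sig m n := by
  simp [spider, Term.substS, Atom.substS]

theorem step_spiderUnfold {Sig : Type} (m n : ℕ) (x : Option Sig) :
    Step (spiderUnfold Sig m n) (List.replicate m x) (List.replicate n x)
      (spider Sig m n) := by
  have h := Step.pref (u := List.replicate m (.bvar 0)) (v := List.replicate n (.bvar 0))
    (P := spider Sig m n) (fun _ => x) (by
      intro y hy
      simp only [List.mem_append, List.mem_replicate] at hy
      rcases hy with ⟨-, rfl⟩ | ⟨-, rfl⟩ <;> rfl)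
  simpa [spiderUnfold, substS_spider, instAtom] using h

theorem behaves_spider (Sig : Type) (m n : ℕ) :
    Behaves (fun P => P = spider Sig m n ∨ P = spiderUnfold Sig m n)
      (fun a b => ∃ x : Option Sig, a = List.replicate m x ∧ b = List.replicate n x) where
  sound := by
    intro P a b Q hs
    induction hs with
    | refl hsort =>
      rintro (rfl | rfl)
      · cases hsort with
        | mu hs =>
          cases hs with
          | pre hk hl =>
            rw [List.length_replicate] at hk hl
            subst hk hl
            exact ⟨⟨none, rfl, rfl⟩, .inl rfl⟩
      · cases hsort with
        | pre hk hl =>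
          rw [List.length_replicate] at hk hl
          subst hk hl
          exact ⟨⟨none, rfl, rfl⟩, .inr rfl⟩
    | iotaL _ _ _ _ ih₁ ih₂ => exact fun hP => ih₂ (ih₁ hP).2
    | iotaR _ _ _ _ ih₁ ih₂ => exact fun hP => ⟨(ih₁ hP).1, (ih₂ (ih₁ hP).2).2⟩
    | pref σ =>
      rintro (heq | heq)
      · cases heq
      · cases heq
        exact ⟨⟨σ 0, by simp [instAtom], by simp [instAtom]⟩, .inl (substS_spider _ _ _)⟩
    | recur _ ih =>
      rintro (heq | heq)
      · cases heq
        exact ih (.inr rfl)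
      · cases heq
    | _ => rintro (heq | heq) <;> cases heq
  complete := by
    rintro _ _ _ (rfl | rfl) ⟨x, rfl, rfl⟩
    · exact ⟨_, .recur (step_spiderUnfold m n x), .inl rfl⟩
    · exact ⟨_, step_spiderUnfold m n x, .inl rfl⟩

/-- the snake (triangle) equations for single wires:
`(d⊗I);(I⊗e) ∼ I` and `(I⊗d);(e⊗I) ∼ I`. -/
theorem snake_one (Sig : Type) :
    Bisim (.seq (.ten (dW Sig) (idW Sig 1)) (.ten (idW Sig 1) (eW Sig)))
          (idW Sig 1) ∧
    Bisim (.seq (.ten (idW Sig 1) (dW Sig)) (.ten (eW Sig) (idW Sig 1)))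
          (idW Sig 1) := by
  have hd := behaves_spider Sig 0 2
  have he := behaves_spider Sig 2 0
  have hi := behaves_spider Sig 1 1
  constructor
  · refine (((hd.ten hi).seq (hi.ten he)).congr fun a b => ⟨?_, ?_⟩).bisim hi
      ⟨_, _, ⟨_, _, .inl rfl, .inl rfl, rfl⟩, ⟨_, _, .inl rfl, .inl rfl, rfl⟩, rfl⟩ (.inl rfl)
    · rintro ⟨_, ⟨_, _, _, _, ⟨x, rfl, rfl⟩, ⟨y, rfl, rfl⟩, rfl, rfl⟩,
        ⟨_, _, _, _, ⟨z, rfl, rfl⟩, ⟨w, rfl, rfl⟩, hc, rfl⟩⟩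
      cases hc
      exact ⟨_, rfl, rfl⟩
    · rintro ⟨x, rfl, rfl⟩
      exact ⟨_, ⟨_, _, _, _, ⟨x, rfl, rfl⟩, ⟨x, rfl, rfl⟩, rfl, rfl⟩,
        ⟨_, _, _, _, ⟨x, rfl, rfl⟩, ⟨x, rfl, rfl⟩, rfl, rfl⟩⟩
  · refine (((hi.ten hd).seq (he.ten hi)).congr fun a b => ⟨?_, ?_⟩).bisim hi
      ⟨_, _, ⟨_, _, .inl rfl, .inl rfl, rfl⟩, ⟨_, _, .inl rfl, .inl rfl, rfl⟩, rfl⟩ (.inl rfl)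
    · rintro ⟨_, ⟨_, _, _, _, ⟨x, rfl, rfl⟩, ⟨y, rfl, rfl⟩, rfl, rfl⟩,
        ⟨_, _, _, _, ⟨z, rfl, rfl⟩, ⟨w, rfl, rfl⟩, hc, rfl⟩⟩
      cases hc
      exact ⟨_, rfl, rfl⟩
    · rintro ⟨x, rfl, rfl⟩
      exact ⟨_, ⟨_, _, _, _, ⟨x, rfl, rfl⟩, ⟨x, rfl, rfl⟩, rfl, rfl⟩,
        ⟨_, _, _, _, ⟨x, rfl, rfl⟩, ⟨x, rfl, rfl⟩, rfl, rfl⟩⟩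

end WireCalc
end

section
/- The dualizing transformation (-)* of the wire calculus swaps sorts and reverses transitions: if P : (k,l) is a sorted term then P* : (l,k), and P →[a⃗/b⃗] R is a transition of the operational semantics if and only if P* →[b⃗*/a⃗*] R* is, where w⃗* denotes the reversal of the word w⃗ over Σ+{ι}. -/
namespace WireCalc

variable {Sig : Type}

theorem Term.star_star (P : Term Sig) : P.star.star = P := by
  induction P <;> simp_all [Term.star]

theorem boundIn_reverse (n : ℕ) (u v : List (Atom Sig)) :
    boundIn n v.reverse u.reverse = boundIn n u v := by
  simp [boundIn, List.any_append, Bool.or_comm]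

theorem freeIn_reverse (n : ℕ) (u v : List (Atom Sig)) :
    freeIn n v.reverse u.reverse = freeIn n u v := by
  simp [freeIn, List.any_append, Bool.or_comm]

theorem bdSet_reverse (u v : List (Atom Sig)) : bdSet v.reverse u.reverse = bdSet u v := by
  simp only [bdSet, boundIn_reverse]

theorem frSet_reverse (u v : List (Atom Sig)) : frSet v.reverse u.reverse = frSet u v := by
  simp only [frSet, freeIn_reverse]

theorem Term.star_substS (P : Term Sig) (σ : ℕ → Option (Option Sig)) :
    (P.substS σ).star = P.star.substS σ := by
  induction P generalizing σ <;> simp_all [Term.star, Term.substS, boundIn_reverse]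

theorem Term.star_shiftP (P : Term Sig) (d c : ℕ) :
    (shiftP d c P).star = shiftP d c P.star := by
  induction P generalizing c <;> simp_all [Term.star, shiftP]

theorem Term.star_substP (P S : Term Sig) (j : ℕ) :
    (substP j S P).star = substP j S.star P.star := by
  induction P generalizing j S with
  | pvar i => simp only [substP, Term.star]; split_ifs <;> rfl
  | _ => simp_all [Term.star, substP, Term.star_shiftP]

theorem Sorted.star {Γ : List (ℕ × ℕ)} {Δ : Set ℕ} {P : Term Sig} {k l : ℕ}
    (h : Sorted Γ Δ P k l) : Sorted (Γ.map Prod.swap) Δ P.star l k := by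
  induction h with
  | pvar h => exact .pvar (by simp [h])
  | seq _ _ ihP ihQ => exact .seq ihQ ihP
  | @ten _ _ _ _ k l m n _ _ ihP ihQ =>
    rw [Nat.add_comm k m, Nat.add_comm l n]
    exact .ten ihQ ihP
  | pre hu hv hdisj hfr _ ih =>
    refine .pre (by simpa using hv) (by simpa using hu) ?_ ?_ ?_
    · rwa [frSet_reverse, bdSet_reverse]
    · rwa [frSet_reverse]
    · rwa [bdSet_reverse]
  | choice _ _ ihP ihQ => exact .choice ihP ihQ
  | mu _ ih => exact .mu ih

theorem IsIota.reverse {w : List (Option Sig)} (h : IsIota w) : IsIota w.reverse :=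
  fun x hx => h x (List.mem_reverse.1 hx)

theorem isIota_reverse_append (a b : List (Option Sig)) :
    IsIota (b.reverse ++ a.reverse) ↔ IsIota (a ++ b) := by
  simp only [IsIota, List.mem_append, List.mem_reverse, or_comm]

theorem Step.star {P R : Term Sig} {a b : List (Option Sig)} (h : Step P a b R) :
    Step P.star b.reverse a.reverse R.star := by
  induction h with
  | refl h =>
    simp only [iotaW, List.reverse_replicate]
    exact .refl h.star
  | iotaL ha hb _ _ ih₁ ih₂ => exact .iotaL hb.reverse ha.reverse ih₁ ih₂
  | iotaR _ ha hb _ ih₁ ih₂ => exact .iotaR ih₁ hb.reverse ha.reverse ih₂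
  | cut _ _ ih₁ ih₂ => exact .cut ih₂ ih₁
  | ten _ _ ih₁ ih₂ =>
    simp only [List.reverse_append]
    exact .ten ih₂ ih₁
  | @pref u v P σ h =>
    have key := Step.pref (u := v.reverse) (v := u.reverse) (P := P.star) σ
      (fun x hx => h x (by simpa [or_comm] using hx))
    simpa only [Term.star, boundIn_reverse, List.map_reverse, ← Term.star_substS] using key
  | choiceIota ha hb _ _ ih₁ ih₂ => exact .choiceIota hb.reverse ha.reverse ih₁ ih₂
  | choiceL hab _ ih => exact .choiceL (by rwa [isIota_reverse_append]) ih
  | choiceR hab _ ih => exact .choiceR (by rwa [isIota_reverse_append]) ih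
  | recur _ ih =>
    rw [Term.star_substP] at ih
    exact .recur ih

/-- the dualizing transformation `(-)*` swaps sorts and
reverses transitions: if `P : (k,l)` then `P* : (l,k)`, and
`P →[a⃗/b⃗] R` iff `P* →[b⃗*/a⃗*] R*`, where `w⃗*` is word reversal. -/
theorem star_sort_and_step (Sig : Type) :
    (∀ (P : Term Sig) (k l : ℕ),
      Sorted [] ∅ P k l → Sorted [] ∅ P.star l k) ∧
    (∀ (P R : Term Sig) (a b : List (Option Sig)) (k l : ℕ),
      Sorted [] ∅ P k l →
      (Step P a b R ↔ Step P.star b.reverse a.reverse R.star)) := by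
  refine ⟨fun P k l h => h.star, fun P R a b k l _ => ⟨Step.star, fun h => ?_⟩⟩
  simpa only [Term.star_star, List.reverse_reverse] using h.star

end WireCalc
end
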